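/- Let ≤ be a monomial order on R^r, let G = (p₁,…,p_k) ∈ R^{k×r} be a ≤-Gröbner basis with μ_i = lm_≤(p_i), let ≺ be a Schreyer order for ≤ and (μ₁,…,μ_k), and let E ∈ R^{(k+n−1)×k} be elementary with pivot π, constants λ_i and α_j, such that λ_i = 0 whenever ε_i ≺ ε_π strictly. If μ_i ≠ μ_π for all i ≠ π and ⟨EG⟩ ≠ ⟨G⟩, then the rows of EG form a ≤-Gröbner basis of the submodule ⟨EG⟩ they generate. -/

import Mathlib

open MvPolynomial

/-! ### Monomials of the free module `R^r`, monomial orders, Gröbner bases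

Here `R = K[X₁,…,Xₙ]` is `MvPolynomial (Fin n) K` and the free module `R^r`
is `Fin r → MvPolynomial (Fin n) K` (row vectors).  A monomial `ν eᵢ` of `R^r`
is encoded as a pair `(ν, i)`. -/

/-- A monomial of the free module `R^r`: an exponent vector in `n` variables
together with the index of the coordinate vector supporting it. -/
abbrev ModMon (n r : ℕ) := (Fin n →₀ ℕ) × Fin r

/-- Multiplication of a module monomial by a ring monomial. -/
noncomputable def smulMon {n r : ℕ} (ν : Fin n →₀ ℕ) (μ : ModMon n r) : ModMon n r :=
  (ν + μ.1, μ.2)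

/-- A monomial order on `R^r`: a total order on the monomials of `R^r` such that
`μ₁ ≤ μ₂` implies `μ₁ ≤ ν·μ₁ ≤ ν·μ₂` for every ring monomial `ν`. -/
structure ModMonomialOrder (n r : ℕ) where
  le : ModMon n r → ModMon n r → Prop
  le_refl : ∀ a, le a a
  le_trans : ∀ a b c, le a b → le b c → le a c
  le_antisymm : ∀ a b, le a b → le b a → a = b
  le_total : ∀ a b, le a b ∨ le b a
  compat : ∀ (ν : Fin n →₀ ℕ) (a b : ModMon n r),
    le a b → le a (smulMon ν a) ∧ le (smulMon ν a) (smulMon ν b)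

/-- The strict order associated with a monomial order. -/
def ModMonomialOrder.lt {n r : ℕ} (ord : ModMonomialOrder n r)
    (a b : ModMon n r) : Prop :=
  ord.le a b ∧ a ≠ b

/-- The module monomial `μ = ν eᵢ` as an element of `R^r`. -/
noncomputable def monElem (K : Type) [Field K] {n r : ℕ} (μ : ModMon n r) :
    Fin r → MvPolynomial (Fin n) K :=
  Pi.single μ.2 (monomial μ.1 (1 : K))

/-- `μ` is the `ord`-leading monomial of `p ∈ R^r`: it appears in `p` and every
monomial appearing in `p` is `≤ μ`. -/
def IsLM {K : Type} [Field K] {n r : ℕ} (ord : ModMonomialOrder n r)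
    (p : Fin r → MvPolynomial (Fin n) K) (μ : ModMon n r) : Prop :=
  coeff μ.1 (p μ.2) ≠ 0 ∧
  ∀ (m : Fin n →₀ ℕ) (i : Fin r), coeff m (p i) ≠ 0 → ord.le (m, i) μ

/-- Divisibility of module monomials: `μ ∣ μ'` iff `μ' = ν·μ` for a ring monomial `ν`. -/
def monDvd {n r : ℕ} (μ μ' : ModMon n r) : Prop :=
  ∃ ν : Fin n →₀ ℕ, smulMon ν μ = μ'

/-- The `ord`-leading module of a submodule `M ⊆ R^r`: the submodule generated by
the leading monomials of the nonzero elements of `M`. -/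
noncomputable def leadingSubmodule {K : Type} [Field K] {n r : ℕ}
    (ord : ModMonomialOrder n r)
    (M : Submodule (MvPolynomial (Fin n) K) (Fin r → MvPolynomial (Fin n) K)) :
    Submodule (MvPolynomial (Fin n) K) (Fin r → MvPolynomial (Fin n) K) :=
  Submodule.span (MvPolynomial (Fin n) K)
    {v | ∃ p ∈ M, ∃ μ : ModMon n r, IsLM ord p μ ∧ v = monElem K μ}

/-- `G` is a `ord`-Gröbner basis of `M`. -/
def IsGB {K : Type} [Field K] {n r : ℕ} {ι : Type} (ord : ModMonomialOrder n r)
    (M : Submodule (MvPolynomial (Fin n) K) (Fin r → MvPolynomial (Fin n) K))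
    (G : ι → Fin r → MvPolynomial (Fin n) K) : Prop :=
  (∀ i, G i ∈ M) ∧
  leadingSubmodule ord M =
    Submodule.span (MvPolynomial (Fin n) K)
      {v | ∃ (i : ι) (μ : ModMon n r), IsLM ord (G i) μ ∧ v = monElem K μ}

/-- `G` is a minimal `ord`-Gröbner basis of `M`: no leading monomial of an element
divides that of another element. -/
def IsMinimalGB {K : Type} [Field K] {n r : ℕ} {ι : Type} (ord : ModMonomialOrder n r)
    (M : Submodule (MvPolynomial (Fin n) K) (Fin r → MvPolynomial (Fin n) K))
    (G : ι → Fin r → MvPolynomial (Fin n) K) : Prop :=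
  IsGB ord M G ∧
  ∀ (i j : ι), i ≠ j → ∀ (μi μj : ModMon n r),
    IsLM ord (G i) μi → IsLM ord (G j) μj → ¬ monDvd μi μj

/-- `G` is the reduced `ord`-Gröbner basis of `M`: minimal, leading coefficients `1`,
and no term of `G i` is divisible by the leading monomial of `G j` for `j ≠ i`. -/
def IsReducedGB {K : Type} [Field K] {n r : ℕ} {ι : Type} (ord : ModMonomialOrder n r)
    (M : Submodule (MvPolynomial (Fin n) K) (Fin r → MvPolynomial (Fin n) K))
    (G : ι → Fin r → MvPolynomial (Fin n) K) : Prop :=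
  IsMinimalGB ord M G ∧
  (∀ (i : ι) (μi : ModMon n r), IsLM ord (G i) μi → coeff μi.1 (G i μi.2) = 1) ∧
  (∀ (i j : ι), i ≠ j → ∀ (μj : ModMon n r), IsLM ord (G j) μj →
    ∀ (m : Fin n →₀ ℕ) (l : Fin r), coeff m (G i l) ≠ 0 → ¬ monDvd μj (m, l))

/-- The rows of the elementary matrix `E ∈ R^{(k+n-1)×k}` with pivot `π`,
constants `lam i` (for `i ≠ π`) and `α j`: the rows `εᵢ + λᵢ ε_π` for `i ≠ π`
and `(Xⱼ - αⱼ) ε_π` for `1 ≤ j ≤ n`. -/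
noncomputable def elemRow {K : Type} [Field K] {n k : ℕ} (π : Fin k)
    (lam : Fin k → K) (α : Fin n → K) :
    ({i : Fin k // i ≠ π} ⊕ Fin n) → Fin k → MvPolynomial (Fin n) K :=
  Sum.elim
    (fun i => Pi.single i.1 (1 : MvPolynomial (Fin n) K)
      + lam i.1 • (Pi.single π 1 : Fin k → MvPolynomial (Fin n) K))
    (fun j => (X j - C (α j)) • (Pi.single π 1 : Fin k → MvPolynomial (Fin n) K))

/-- Rows of the matrix product `E·G` where `E` has rows in `R^k` indexed by `ι`
and `G ∈ R^{k×r}`. -/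
noncomputable def rowMul {K : Type} [Field K] {n k r : ℕ} {ι : Type}
    (E : ι → Fin k → MvPolynomial (Fin n) K)
    (G : Fin k → Fin r → MvPolynomial (Fin n) K) :
    ι → Fin r → MvPolynomial (Fin n) K :=
  fun a c => ∑ b, E a b * G b c

/-- `sord` is a Schreyer order for `ord` and the list of monomials `LM`. -/
def IsSchreyerOrder {n r k : ℕ} (ord : ModMonomialOrder n r)
    (LM : Fin k → ModMon n r) (sord : ModMonomialOrder n k) : Prop :=
  ∀ (ν₁ ν₂ : Fin n →₀ ℕ) (i j : Fin k),
    ord.lt (smulMon ν₁ (LM i)) (smulMon ν₂ (LM j)) → sord.le (ν₁, i) (ν₂, j)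

/-- Row vector times matrix, as a linear map `R^r → R^s`. -/
noncomputable def vecMulLin {K : Type} [Field K] {n r s : ℕ}
    (F : Fin r → Fin s → MvPolynomial (Fin n) K) :
    (Fin r → MvPolynomial (Fin n) K) →ₗ[MvPolynomial (Fin n) K]
      (Fin s → MvPolynomial (Fin n) K) :=
  Matrix.vecMulLinear (Matrix.of F)

/-- The syzygy module `Syz_N(F) = {p ∈ R^r : pF ∈ N}`. -/
noncomputable def Syz {K : Type} [Field K] {n r s : ℕ}
    (N : Submodule (MvPolynomial (Fin n) K) (Fin s → MvPolynomial (Fin n) K))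
    (F : Fin r → Fin s → MvPolynomial (Fin n) K) :
    Submodule (MvPolynomial (Fin n) K) (Fin r → MvPolynomial (Fin n) K) :=
  Submodule.comap (vecMulLin F) N

/-- `keepIdx K μ π j` holds iff `Xⱼ·μ_π` does not belong to the submodule of `R^r`
generated by the monomials `μ i`, `i ≠ π`. -/
def keepIdx (K : Type) [Field K] {n r k : ℕ} (μ : Fin k → ModMon n r) (π : Fin k)
    (j : Fin n) : Prop :=
  monElem K (smulMon (Finsupp.single j 1) (μ π)) ∉
    Submodule.span (MvPolynomial (Fin n) K)
      {v | ∃ i : Fin k, i ≠ π ∧ v = monElem K (μ i)}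

/-- The rows of the submatrix of the elementary matrix with pivot `π` keeping,
among the rows `(Xⱼ - αⱼ) ε_π`, only those with `P j`. -/
noncomputable def prunedRow {K : Type} [Field K] {n k : ℕ} (π : Fin k)
    (lam : Fin k → K) (α : Fin n → K) (P : Fin n → Prop) :
    ({i : Fin k // i ≠ π} ⊕ {j : Fin n // P j}) → Fin k → MvPolynomial (Fin n) K :=
  Sum.elim
    (fun i => Pi.single i.1 (1 : MvPolynomial (Fin n) K)
      + lam i.1 • (Pi.single π 1 : Fin k → MvPolynomial (Fin n) K))
    (fun j => (X j.1 - C (α j.1)) • (Pi.single π 1 : Fin k → MvPolynomial (Fin n) K))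

namespace ModMonomialOrder

variable {n r : ℕ} (ord : ModMonomialOrder n r)

lemma lt_of_not_le {a b : ModMon n r} (h : ¬ ord.le a b) : ord.lt b a :=
  ⟨(ord.le_total a b).resolve_left h, fun e => h (e ▸ ord.le_refl b)⟩

lemma lt_of_le_of_lt {a b c : ModMon n r} (h : ord.le a b) (h' : ord.lt b c) : ord.lt a c := by
  refine ⟨ord.le_trans _ _ _ h h'.1, ?_⟩
  rintro rfl
  exact h'.2 (ord.le_antisymm _ _ h'.1 h)

lemma le_smulMon (ν : Fin n →₀ ℕ) (a : ModMon n r) : ord.le a (smulMon ν a) :=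
  (ord.compat ν a a (ord.le_refl a)).1

lemma le_of_monDvd {a b : ModMon n r} (h : monDvd a b) : ord.le a b := by
  obtain ⟨ν, rfl⟩ := h
  exact ord.le_smulMon ν a

/-- By Dickson's lemma, monomial orders are well-founded. -/
lemma wellFounded_lt : WellFounded ord.lt := by
  rw [wellFounded_iff_isEmpty_descending_chain]
  refine ⟨fun ⟨f, hf⟩ => ?_⟩
  have hlt : ∀ i d, ord.lt (f (i + d + 1)) (f i) := by
    intro i d
    induction d with
    | zero => exact hf i
    | succ d ih => exact ord.lt_of_le_of_lt (hf _).1 ih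
  obtain ⟨i, j, hij, h1, h2⟩ :=
    ((wellQuasiOrdered_le (α := Fin n →₀ ℕ)).prod
      (Finite.wellQuasiOrdered (· = · : Fin r → Fin r → Prop))) f
  obtain ⟨d, rfl⟩ := Nat.exists_eq_add_of_lt hij
  have hdvd : monDvd (f i) (f (i + d + 1)) :=
    ⟨(f (i + d + 1)).1 - (f i).1, Prod.ext (tsub_add_cancel_of_le h1) h2⟩
  exact (hlt i d).2 (ord.le_antisymm _ _ (hlt i d).1 (ord.le_of_monDvd hdvd))

lemma exists_greatest (s : Finset (ModMon n r)) (hs : s.Nonempty) :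
    ∃ m ∈ s, ∀ x ∈ s, ord.le x m := by
  induction hs using Finset.Nonempty.cons_induction with
  | singleton a => exact ⟨a, by simp, by simp [ord.le_refl]⟩
  | cons a s ha hs ih =>
    obtain ⟨m, hm, hmax⟩ := ih
    rcases ord.le_total a m with h | h
    · refine ⟨m, by simp [hm], fun x hx => ?_⟩
      rcases Finset.mem_cons.1 hx with rfl | hx
      exacts [h, hmax x hx]
    · refine ⟨a, by simp, fun x hx => ?_⟩
      rcases Finset.mem_cons.1 hx with rfl | hx
      exacts [ord.le_refl _, ord.le_trans _ _ _ (hmax x hx) h]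

end ModMonomialOrder

section LeadingMonomial

variable {K : Type} [Field K] {n r : ℕ} {ord : ModMonomialOrder n r}

lemma exists_isLM (ord : ModMonomialOrder n r) {p : Fin r → MvPolynomial (Fin n) K}
    (hp : p ≠ 0) : ∃ μ, IsLM ord p μ := by
  classical
  let s : Finset (ModMon n r) :=
    Finset.univ.biUnion fun i => (p i).support.image fun m => (m, i)
  have hmem : ∀ m i, (m, i) ∈ s ↔ coeff m (p i) ≠ 0 := by
    intro m i
    simp [s]
  have hs : s.Nonempty := by
    obtain ⟨i, hi⟩ := Function.ne_iff.1 hp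
    obtain ⟨m, hm⟩ := MvPolynomial.ne_zero_iff.1 hi
    exact ⟨(m, i), (hmem m i).2 hm⟩
  obtain ⟨μ, hμ, hmax⟩ := ord.exists_greatest s hs
  exact ⟨μ, (hmem _ _).1 hμ, fun m i h => hmax _ ((hmem m i).2 h)⟩

lemma IsLM.unique {p : Fin r → MvPolynomial (Fin n) K} {μ μ' : ModMon n r}
    (h : IsLM ord p μ) (h' : IsLM ord p μ') : μ = μ' :=
  ord.le_antisymm _ _ (h'.2 _ _ h.1) (h.2 _ _ h'.1)

lemma IsLM.add_smul {p q : Fin r → MvPolynomial (Fin n) K} {μ ν : ModMon n r}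
    (hp : IsLM ord p μ) (hq : IsLM ord q ν) (hlt : ord.lt ν μ) (c : K) :
    IsLM ord (p + c • q) μ := by
  constructor
  · have h0 : coeff μ.1 (q μ.2) = 0 := by
      by_contra h
      exact hlt.2 (ord.le_antisymm _ _ hlt.1 (hq.2 _ _ h))
    simpa [h0] using hp.1
  · intro m i h
    by_cases h1 : coeff m (p i) = 0
    · by_cases h2 : coeff m (q i) = 0
      · simp [h1, h2] at h
      · exact ord.le_trans _ _ _ (hq.2 _ _ h2) hlt.1
    · exact hp.2 _ _ h1

lemma IsLM.monomial_smul {p : Fin r → MvPolynomial (Fin n) K} {μ : ModMon n r}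
    (hp : IsLM ord p μ) (ν : Fin n →₀ ℕ) :
    IsLM ord (monomial ν (1 : K) • p) (smulMon ν μ) := by
  constructor
  · simpa [smulMon, coeff_monomial_mul] using hp.1
  · intro m i h
    simp only [Pi.smul_apply, smul_eq_mul, coeff_monomial_mul'] at h
    split_ifs at h with hm
    · have := (ord.compat ν _ _ (hp.2 (m - ν) i (by simpa using h))).2
      simpa [smulMon, add_tsub_cancel_of_le hm] using this
    · exact absurd rfl h

lemma IsLM.X_sub_C_smul {p : Fin r → MvPolynomial (Fin n) K} {μ : ModMon n r}
    (hp : IsLM ord p μ) (j : Fin n) (a : K) :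
    IsLM ord ((X j - C a) • p) (smulMon (Finsupp.single j 1) μ) := by
  have hlt : ord.lt μ (smulMon (Finsupp.single j 1) μ) := by
    refine ⟨ord.le_smulMon _ _, fun h => ?_⟩
    have := DFunLike.congr_fun (congrArg Prod.fst h) j
    simp [smulMon] at this
  have heq : (X j - C a) • p = monomial (Finsupp.single j 1) (1 : K) • p + (-a) • p := by
    ext1 i
    simp [add_mul, X, ← C_mul', sub_eq_add_neg]
  rw [heq]
  exact (hp.monomial_smul _).add_smul hp hlt _

lemma IsLM.exists_sub_smul_lt {p q : Fin r → MvPolynomial (Fin n) K} {μ : ModMon n r}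
    (hp : IsLM ord p μ) (hq : IsLM ord q μ) :
    ∃ c : K, ∀ m i, coeff m ((p - c • q) i) ≠ 0 → ord.lt (m, i) μ := by
  refine ⟨coeff μ.1 (p μ.2) / coeff μ.1 (q μ.2), fun m i h => ⟨?_, ?_⟩⟩
  · by_cases h1 : coeff m (p i) = 0
    · by_cases h2 : coeff m (q i) = 0
      · simp [h1, h2] at h
      · exact hq.2 _ _ h2
    · exact hp.2 _ _ h1
  · rintro rfl
    have := hq.1
    simp_all

/-- A monomial appearing in an element of a monomial submodule is divisible by one of the
generators. -/
lemma exists_monDvd_of_mem_span {S : Set (ModMon n r)} {v : Fin r → MvPolynomial (Fin n) K}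
    (hv : v ∈ Submodule.span (MvPolynomial (Fin n) K) (monElem K '' S)) :
    ∀ m i, coeff m (v i) ≠ 0 → ∃ ν ∈ S, monDvd ν (m, i) := by
  classical
  induction hv using Submodule.span_induction with
  | mem x hx =>
    obtain ⟨ν, hν, rfl⟩ := hx
    intro m i h
    refine ⟨ν, hν, 0, ?_⟩
    by_cases hi : i = ν.2
    · subst hi
      by_cases hm : ν.1 = m
      · subst hm
        simp [smulMon]
      · simp [monElem, coeff_monomial, hm] at h
    · simp [monElem, hi] at h
  | zero => simp
  | add x y _ _ hx hy =>
    intro m i h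
    by_cases h1 : coeff m (x i) = 0
    · exact hy m i (by simpa [h1] using h)
    · exact hx m i h1
  | smul a x _ hx =>
    intro m i h
    rw [Pi.smul_apply, smul_eq_mul, coeff_mul] at h
    obtain ⟨⟨m₁, m₂⟩, hm, h⟩ := Finset.exists_ne_zero_of_sum_ne_zero h
    obtain ⟨ν, hν, ξ, hξ⟩ := hx m₂ i (right_ne_zero_of_mul h)
    obtain rfl : m₁ + m₂ = m := by simpa using hm
    refine ⟨ν, hν, m₁ + ξ, ?_⟩
    simp only [smulMon, Prod.mk.injEq] at hξ ⊢
    exact ⟨by rw [add_assoc, hξ.1], hξ.2⟩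

variable {ι : Type} {M : Submodule (MvPolynomial (Fin n) K) (Fin r → MvPolynomial (Fin n) K)}
  {G : ι → Fin r → MvPolynomial (Fin n) K} {μ : ι → ModMon n r}

lemma IsGB.exists_monDvd (hGB : IsGB ord M G) (hμ : ∀ i, IsLM ord (G i) (μ i))
    {p : Fin r → MvPolynomial (Fin n) K} (hp : p ∈ M) {ν : ModMon n r} (hν : IsLM ord p ν) :
    ∃ i, monDvd (μ i) ν := by
  have hmem : monElem K ν ∈ leadingSubmodule ord M :=
    Submodule.subset_span ⟨p, hp, ν, hν, rfl⟩
  rw [hGB.2] at hmem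
  have hset : {v | ∃ (i : ι) (ξ : ModMon n r), IsLM ord (G i) ξ ∧ v = monElem K ξ} ⊆
      monElem K '' Set.range μ := by
    rintro _ ⟨i, ξ, hξ, rfl⟩
    exact ⟨ξ, ⟨i, (hμ i).unique hξ⟩, rfl⟩
  obtain ⟨_, ⟨i, rfl⟩, h⟩ := exists_monDvd_of_mem_span (Submodule.span_mono hset hmem) ν.1 ν.2
    (by simp [monElem])
  exact ⟨i, h⟩

/-- An element of `M` all of whose monomials are smaller than `μ₀` reduces to zero using only the
Gröbner basis elements whose leading monomials are smaller than `μ₀`. -/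
lemma IsGB.mem_of_forall_lt (hGB : IsGB ord M G) (hμ : ∀ i, IsLM ord (G i) (μ i))
    {N : Submodule (MvPolynomial (Fin n) K) (Fin r → MvPolynomial (Fin n) K)}
    {μ₀ : ModMon n r} (hN : ∀ i, ord.lt (μ i) μ₀ → G i ∈ N)
    {p : Fin r → MvPolynomial (Fin n) K} (hp : p ∈ M)
    (hlt : ∀ m i, coeff m (p i) ≠ 0 → ord.lt (m, i) μ₀) : p ∈ N := by
  have key : ∀ ν, ∀ f ∈ M, IsLM ord f ν → ord.lt ν μ₀ → f ∈ N := by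
    intro ν
    induction ν using ord.wellFounded_lt.induction with
    | h ν ih =>
    intro f hf hν hν₀
    obtain ⟨i, ξ, rfl⟩ := hGB.exists_monDvd hμ hf hν
    have hi : G i ∈ N := hN i (ord.lt_of_le_of_lt (ord.le_smulMon _ _) hν₀)
    obtain ⟨c, hc⟩ := hν.exists_sub_smul_lt ((hμ i).monomial_smul ξ)
    have hrem : f - c • monomial ξ (1 : K) • G i ∈ N := by
      by_cases h0 : f - c • monomial ξ (1 : K) • G i = 0
      · rw [h0]
        exact N.zero_mem
      · obtain ⟨ν', hν'⟩ := exists_isLM ord h0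
        have hlt' := hc _ _ hν'.1
        exact ih ν' hlt' _
          (M.sub_mem hf (M.smul_of_tower_mem c (M.smul_mem _ (hGB.1 i)))) hν'
          (ord.lt_of_le_of_lt hlt'.1 hν₀)
    have := N.add_mem hrem (N.smul_of_tower_mem c (N.smul_mem (monomial ξ (1 : K)) hi))
    simpa using this
  by_cases h0 : p = 0
  · rw [h0]
    exact N.zero_mem
  · obtain ⟨ν, hν⟩ := exists_isLM ord h0
    exact key ν p hp hν (hlt _ _ hν.1)

lemma monElem_mem_span_of_monDvd {S : Set (Fin r → MvPolynomial (Fin n) K)} {ν ξ : ModMon n r}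
    (hν : monElem K ν ∈ Submodule.span (MvPolynomial (Fin n) K) S) (h : monDvd ν ξ) :
    monElem K ξ ∈ Submodule.span (MvPolynomial (Fin n) K) S := by
  obtain ⟨ζ, rfl⟩ := h
  have heq : monElem K (smulMon ζ ν) = monomial ζ (1 : K) • monElem K ν := by
    simp [monElem, smulMon, ← Pi.single_smul, monomial_mul]
  rw [heq]
  exact Submodule.smul_mem _ _ hν

end LeadingMonomial

section ElementaryMatrix

variable {K : Type} [Field K] {n r k : ℕ} (π : Fin k) (lam : Fin k → K) (α : Fin n → K)
  (G : Fin k → Fin r → MvPolynomial (Fin n) K)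

lemma rowMul_elemRow_inl (i : {i : Fin k // i ≠ π}) :
    rowMul (elemRow π lam α) G (Sum.inl i) = G i.1 + lam i.1 • G π := by
  ext1 c
  simp [rowMul, elemRow, add_mul, Finset.sum_add_distrib, Pi.single_apply]

lemma rowMul_elemRow_inr (j : Fin n) :
    rowMul (elemRow π lam α) G (Sum.inr j) = (X j - C (α j)) • G π := by
  ext1 c
  simp [rowMul, elemRow, Pi.single_apply]

lemma span_rowMul_elemRow_le :
    Submodule.span (MvPolynomial (Fin n) K) (Set.range (rowMul (elemRow π lam α) G)) ≤
      Submodule.span (MvPolynomial (Fin n) K) (Set.range G) := by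
  have hG : ∀ i, G i ∈ Submodule.span (MvPolynomial (Fin n) K) (Set.range G) :=
    fun i => Submodule.subset_span ⟨i, rfl⟩
  rw [Submodule.span_le]
  rintro _ ⟨i | j, rfl⟩
  · rw [rowMul_elemRow_inl]
    exact Submodule.add_mem _ (hG _) (Submodule.smul_of_tower_mem _ _ (hG _))
  · rw [rowMul_elemRow_inr]
    exact Submodule.smul_mem _ _ (hG _)

lemma span_rowMul_elemRow_eq_of_mem
    (h : G π ∈ Submodule.span (MvPolynomial (Fin n) K)
      (Set.range (rowMul (elemRow π lam α) G))) :
    Submodule.span (MvPolynomial (Fin n) K) (Set.range (rowMul (elemRow π lam α) G)) =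
      Submodule.span (MvPolynomial (Fin n) K) (Set.range G) := by
  refine le_antisymm (span_rowMul_elemRow_le π lam α G) ?_
  rw [Submodule.span_le]
  rintro _ ⟨i, rfl⟩
  by_cases hi : i = π
  · rwa [hi]
  · have hrow := Submodule.subset_span (R := MvPolynomial (Fin n) K)
      (Set.mem_range_self (f := rowMul (elemRow π lam α) G) (Sum.inl ⟨i, hi⟩))
    rw [rowMul_elemRow_inl] at hrow
    simpa using Submodule.sub_mem _ hrow (Submodule.smul_of_tower_mem _ (lam i) h)

end ElementaryMatrix

/-- If `μᵢ ≠ μ_π` for all `i ≠ π` and `⟨EG⟩ ≠ ⟨G⟩`, then the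
rows of `E·G` form a `≤`-Gröbner basis of the submodule they generate. -/
theorem statement7 {K : Type} [Field K] {n r k : ℕ}
    (ord : ModMonomialOrder n r)
    (G : Fin k → Fin r → MvPolynomial (Fin n) K)
    (hGB : IsGB ord
      (Submodule.span (MvPolynomial (Fin n) K) (Set.range G)) G)
    (μ : Fin k → ModMon n r) (hμ : ∀ i, IsLM ord (G i) (μ i))
    (sord : ModMonomialOrder n k) (hs : IsSchreyerOrder ord μ sord)
    (π : Fin k) (lam : Fin k → K) (α : Fin n → K)
    (hlam : ∀ i : Fin k, i ≠ π →
      sord.lt ((0 : Fin n →₀ ℕ), i) ((0 : Fin n →₀ ℕ), π) → lam i = 0)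
    (hdist : ∀ i : Fin k, i ≠ π → μ i ≠ μ π)
    (hne : Submodule.span (MvPolynomial (Fin n) K)
        (Set.range (rowMul (elemRow π lam α) G)) ≠
      Submodule.span (MvPolynomial (Fin n) K) (Set.range G)) :
    IsGB ord
      (Submodule.span (MvPolynomial (Fin n) K)
        (Set.range (rowMul (elemRow π lam α) G)))
      (rowMul (elemRow π lam α) G) := by
  have hlam_of_lt : ∀ i, i ≠ π → ord.lt (μ i) (μ π) → lam i = 0 := by
    intro i hi hlt
    refine hlam i hi ⟨hs 0 0 i π (by simpa [smulMon] using hlt), fun h => hi ?_⟩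
    exact congrArg Prod.snd h
  have hrow_inl : ∀ i : {i : Fin k // i ≠ π},
      IsLM ord (rowMul (elemRow π lam α) G (Sum.inl i)) (μ i.1) := by
    intro i
    rw [rowMul_elemRow_inl]
    by_cases h : ord.le (μ i.1) (μ π)
    · rw [hlam_of_lt i.1 i.2 ⟨h, hdist i.1 i.2⟩, zero_smul, add_zero]
      exact hμ i.1
    · exact (hμ i.1).add_smul (hμ π) (ord.lt_of_not_le h) _
  have hrow_inr : ∀ j : Fin n, IsLM ord (rowMul (elemRow π lam α) G (Sum.inr j))
      (smulMon (Finsupp.single j 1) (μ π)) := by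
    intro j
    rw [rowMul_elemRow_inr]
    exact (hμ π).X_sub_C_smul j _
  have hsmall : ∀ i, ord.lt (μ i) (μ π) → G i ∈ Submodule.span (MvPolynomial (Fin n) K)
      (Set.range (rowMul (elemRow π lam α) G)) := by
    intro i hlt
    have hi : i ≠ π := by
      rintro rfl
      exact hlt.2 rfl
    have hrow := rowMul_elemRow_inl π lam α G ⟨i, hi⟩
    rw [hlam_of_lt i hi hlt, zero_smul, add_zero] at hrow
    exact Submodule.subset_span ⟨_, hrow⟩
  refine ⟨fun i => Submodule.subset_span ⟨i, rfl⟩, le_antisymm ?_ ?_⟩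
  · refine Submodule.span_le.2 ?_
    rintro _ ⟨p, hp, ν, hν, rfl⟩
    have hpG := span_rowMul_elemRow_le π lam α G hp
    obtain ⟨i, hi⟩ := hGB.exists_monDvd hμ hpG hν
    by_cases hiπ : i = π
    · subst hiπ
      obtain ⟨ξ, rfl⟩ := hi
      by_cases hξ : ξ = 0
      · have hν' : IsLM ord p (μ i) := by simpa [smulMon, hξ] using hν
        obtain ⟨c, hc⟩ := (hμ i).exists_sub_smul_lt hν'
        have hrem := hGB.mem_of_forall_lt hμ hsmall
          (Submodule.sub_mem _ (hGB.1 i) (Submodule.smul_of_tower_mem _ c hpG)) hc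
        refine absurd (span_rowMul_elemRow_eq_of_mem i lam α G ?_) hne
        simpa using Submodule.add_mem _ hrem (Submodule.smul_of_tower_mem _ c hp)
      · obtain ⟨j, hj⟩ := Finsupp.ne_iff.1 hξ
        have hle : Finsupp.single j 1 ≤ ξ := by
          rw [Finsupp.single_le_iff]
          exact Nat.one_le_iff_ne_zero.2 hj
        refine monElem_mem_span_of_monDvd
          (Submodule.subset_span ⟨Sum.inr j, _, hrow_inr j, rfl⟩)
          ⟨ξ - Finsupp.single j 1, ?_⟩
        simp only [smulMon, ← add_assoc, tsub_add_cancel_of_le hle]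
    · exact monElem_mem_span_of_monDvd
        (Submodule.subset_span ⟨Sum.inl ⟨i, hiπ⟩, _, hrow_inl ⟨i, hiπ⟩, rfl⟩) hi
  · refine Submodule.span_mono ?_
    rintro _ ⟨i, ν, hν, rfl⟩
    exact ⟨_, Submodule.subset_span ⟨i, rfl⟩, ν, hν, rfl⟩
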